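/- For every even integer N ≥ 6 divisible by 6 there exists a simple orthogonal polygon with integer edge lengths and perimeter N that requires at least N/6 point guards. -/

import Mathlib

/-- The cross product of two planar vectors. -/
def cross (u v : ℝ × ℝ) : ℝ := u.1 * v.2 - u.2 * v.1

/-- A simple orthogonal polygon with `n` vertices, indexed cyclically by `ZMod n`:
all edges axis-parallel, consecutive edges perpendicular (genuine corners), and
edges intersect only as prescribed for a simple closed polygon. -/
structure OrthoPolygon (n : ℕ) where
  vertex : ZMod n → ℝ × ℝ
  inj : Function.Injective vertex
  axis : ∀ i : ZMod n,
    (vertex i).1 = (vertex (i + 1)).1 ∨ (vertex i).2 = (vertex (i + 1)).2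
  corner : ∀ i : ZMod n,
    ((vertex i).1 = (vertex (i + 1)).1 → (vertex (i + 1)).2 = (vertex (i + 1 + 1)).2) ∧
    ((vertex i).2 = (vertex (i + 1)).2 → (vertex (i + 1)).1 = (vertex (i + 1 + 1)).1)
  nonadj_disjoint : ∀ i j : ZMod n, i ≠ j → i + 1 ≠ j → j + 1 ≠ i →
    Disjoint (segment ℝ (vertex i) (vertex (i + 1)))
      (segment ℝ (vertex j) (vertex (j + 1)))
  adj_inter : ∀ i : ZMod n,
    segment ℝ (vertex i) (vertex (i + 1)) ∩
      segment ℝ (vertex (i + 1)) (vertex (i + 1 + 1)) = {vertex (i + 1)}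

/-- The vertex `i` is reflex (interior angle `3π/2`), for a counterclockwise traversal. -/
def OrthoPolygon.ReflexAt {n : ℕ} (P : OrthoPolygon n) (i : ZMod n) : Prop :=
  cross (P.vertex i - P.vertex (i - 1)) (P.vertex (i + 1) - P.vertex i) < 0

/-- The polygon is traversed counterclockwise (positive signed area). -/
def OrthoPolygon.CCW {n : ℕ} [NeZero n] (P : OrthoPolygon n) : Prop :=
  0 < ∑ i : ZMod n, cross (P.vertex i) (P.vertex (i + 1))

/-- An integral orthogonal polygon: a simple orthogonal polygon all of whose edges have
integer length, together with the closed region it bounds. -/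
structure IntegralOrthoPolygon (n : ℕ) extends OrthoPolygon n where
  integral_edges : ∀ i : ZMod n, ∃ a : ℕ, dist (vertex i) (vertex (i + 1)) = (a : ℝ)
  region : Set (ℝ × ℝ)
  region_compact : IsCompact region
  region_frontier : frontier region = ⋃ i : ZMod n, segment ℝ (vertex i) (vertex (i + 1))

/-- `p` sees `q` within the region `R` if the segment between them lies in `R`. -/
def Sees (R : Set (ℝ × ℝ)) (p q : ℝ × ℝ) : Prop := segment ℝ p q ⊆ R

/-- A set `S` of points guards the region `R` if `S ⊆ R` and every point of `R` is seen
by some point of `S`. -/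
def GuardsRegion (R : Set (ℝ × ℝ)) (S : Set (ℝ × ℝ)) : Prop :=
  S ⊆ R ∧ ∀ q ∈ R, ∃ p ∈ S, Sees R p q

namespace Comb

/-- The lower end of the vertical boundary edge on the line `x = s` of the comb with `k` prongs. -/
def low (k s : ℕ) : ℕ := if s = 0 then 0 else if s + 1 = 2 * k then 0 else 1

/-- The height of the horizontal edge of the serrated side above `[s, s + 1]`. -/
def roof (s : ℕ) : ℕ := if s % 2 = 0 then 2 else 1

/-- The second coordinate of the `v`-th vertex of the comb with `k` prongs. -/
def height (k v : ℕ) : ℕ := if v % 4 = 1 ∨ v % 4 = 2 then 2 else low k (v / 2)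

/-- The vertices of the comb with `k` prongs, starting at the origin and going along the
serrated side. -/
def corner (k v : ℕ) : ℝ × ℝ := (((v / 2 : ℕ) : ℝ), (height k v : ℝ))

/-- The `v`-th boundary edge of the comb with `k` prongs, in coordinates. -/
def edge (k v : ℕ) : Set (ℝ × ℝ) :=
  {p | (∃ s, s < 2 * k ∧ v = 2 * s ∧ p.1 = s ∧ (low k s : ℝ) ≤ p.2 ∧ p.2 ≤ 2) ∨
    (∃ s, s + 1 < 2 * k ∧ v = 2 * s + 1 ∧ p.2 = roof s ∧ (s : ℝ) ≤ p.1 ∧ p.1 ≤ s + 1) ∨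
    (v + 1 = 4 * k ∧ p.2 = 0 ∧ 0 ≤ p.1 ∧ p.1 ≤ 2 * k - 1)}

/-- The closed region bounded by the comb with `k` prongs. -/
def region (k : ℕ) : Set (ℝ × ℝ) :=
  Set.Icc (0 : ℝ) (2 * k - 1) ×ˢ Set.Icc (0 : ℝ) 1 ∪
    ⋃ j ∈ Finset.range k, Set.Icc (2 * j : ℝ) (2 * j + 1) ×ˢ Set.Icc (0 : ℝ) 2

theorem segment_of_fst_eq (x a b : ℝ) :
    segment ℝ (x, a) (x, b) = {p | p.1 = x ∧ p.2 ∈ Set.uIcc a b} := by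
  rw [← Prod.image_mk_segment_right, segment_eq_uIcc]
  ext ⟨u, w⟩
  simp only [Set.mem_image, Prod.mk.injEq, Set.mem_ofPred_eq]
  constructor
  · rintro ⟨z, hz, rfl, rfl⟩
    exact ⟨rfl, hz⟩
  · rintro ⟨rfl, hw⟩
    exact ⟨w, hw, rfl, rfl⟩

theorem segment_of_snd_eq (y a b : ℝ) :
    segment ℝ (a, y) (b, y) = {p | p.2 = y ∧ p.1 ∈ Set.uIcc a b} := by
  rw [← Prod.image_mk_segment_left, segment_eq_uIcc]
  ext ⟨u, w⟩
  simp only [Set.mem_image, Prod.mk.injEq, Set.mem_ofPred_eq]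
  constructor
  · rintro ⟨z, hz, rfl, rfl⟩
    exact ⟨rfl, hz⟩
  · rintro ⟨rfl, hw⟩
    exact ⟨u, hw, rfl, rfl⟩

theorem segment_inter_segment_of_fst_eq {a b c : ℝ × ℝ} (hab : a.1 = b.1) (hbc : b.2 = c.2) :
    segment ℝ a b ∩ segment ℝ b c = {b} := by
  refine Set.Subset.antisymm ?_ ?_
  · obtain ⟨a₁, a₂⟩ := a
    obtain ⟨b₁, b₂⟩ := b
    obtain ⟨c₁, c₂⟩ := c
    obtain rfl : a₁ = b₁ := hab
    obtain rfl : b₂ = c₂ := hbc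
    rw [segment_of_fst_eq, segment_of_snd_eq]
    rintro p ⟨⟨h1, -⟩, h2, -⟩
    exact Prod.ext h1 h2
  · rintro p rfl
    exact ⟨right_mem_segment ℝ _ _, left_mem_segment ℝ _ _⟩

/-- The index following `v` in the cyclic order of the `4 * k` vertices. -/
def next (k v : ℕ) : ℕ := if v + 1 = 4 * k then 0 else v + 1

theorem val_add_one {k : ℕ} (hk : 0 < k) (i : ZMod (4 * k)) :
    (i + 1).val = next k i.val := by
  have : NeZero (4 * k) := ⟨by omega⟩
  have : Fact (1 < 4 * k) := ⟨by omega⟩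
  have hi := ZMod.val_lt i
  rw [ZMod.val_add, ZMod.val_one, next]
  split_ifs with h
  · rw [h, Nat.mod_self]
  · exact Nat.mod_eq_of_lt (by omega)

theorem low_le_one (k s : ℕ) : low k s ≤ 1 := by
  unfold low; split_ifs <;> omega

/-- The three kinds of indices: left or right sides, tops, and the base. -/
theorem index_cases {k v : ℕ} (hv : v < 4 * k) :
    (∃ s, s < 2 * k ∧ v = 2 * s) ∨ (∃ s, s + 1 < 2 * k ∧ v = 2 * s + 1) ∨ v + 1 = 4 * k := by
  rcases Nat.even_or_odd' v with ⟨s, h | h⟩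
  · exact Or.inl ⟨s, by omega, h⟩
  · by_cases h' : v + 1 = 4 * k
    · exact Or.inr (Or.inr h')
    · exact Or.inr (Or.inl ⟨s, by omega, h⟩)

theorem corner_even (k s : ℕ) :
    corner k (2 * s) = ((s : ℝ), ((if s % 2 = 0 then low k s else 2 : ℕ) : ℝ)) := by
  have h1 : 2 * s / 2 = s := by omega
  unfold corner height
  rw [h1]
  congr 2
  split_ifs <;> first | rfl | omega

theorem corner_odd (k s : ℕ) :
    corner k (2 * s + 1) = ((s : ℝ), ((if s % 2 = 0 then 2 else low k s : ℕ) : ℝ)) := by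
  have h1 : (2 * s + 1) / 2 = s := by omega
  unfold corner height
  rw [h1]
  congr 2
  split_ifs <;> first | rfl | omega

theorem corner_top_left {k s : ℕ} (hs : s + 1 < 2 * k) :
    corner k (2 * s + 1) = ((s : ℝ), (roof s : ℝ)) := by
  rw [corner_odd]
  congr 2
  unfold roof low
  split_ifs <;> first | rfl | omega

theorem corner_top_right (k s : ℕ) :
    corner k (2 * s + 1 + 1) = ((s : ℝ) + 1, (roof s : ℝ)) := by
  rw [show 2 * s + 1 + 1 = 2 * (s + 1) by ring, corner_even]
  push_cast
  congr 1
  unfold roof low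
  split_ifs <;> first | contradiction | omega | (push_cast; rfl)

theorem corner_zero (k : ℕ) : corner k 0 = (0, 0) := by
  simp [corner, height, low]

theorem corner_last {k v : ℕ} (hv : v + 1 = 4 * k) : corner k v = ((2 * k - 1 : ℝ), (0 : ℝ)) := by
  obtain rfl : v = 2 * (2 * k - 1) + 1 := by omega
  rw [corner_odd]
  have h1 : ((2 * k - 1 : ℕ) : ℝ) = 2 * k - 1 := by
    rw [Nat.cast_sub (by omega)]; push_cast; ring
  have h2 : (2 * k - 1) % 2 = 1 := by omega
  have h3 : 2 * k - 1 + 1 = 2 * k := by omega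
  simp [h1, h2, h3, low]

theorem next_even {k s : ℕ} : next k (2 * s) = 2 * s + 1 := by
  unfold next; split_ifs <;> omega

theorem next_odd {k s : ℕ} (hs : s + 1 < 2 * k) : next k (2 * s + 1) = 2 * s + 1 + 1 := by
  unfold next; split_ifs <;> omega

theorem next_last {k v : ℕ} (hv : v + 1 = 4 * k) : next k v = 0 := by
  simp [next, hv]

theorem next_lt {k v : ℕ} (hv : v < 4 * k) : next k v < 4 * k := by
  unfold next; split_ifs <;> omega

theorem next_mod_two (k v : ℕ) : next k v % 2 = (v + 1) % 2 := by
  unfold next; split_ifs <;> omega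

theorem fst_corner_next {k v : ℕ} :
    (corner k v).1 = (corner k (next k v)).1 ↔ v % 2 = 0 := by
  simp only [corner, Nat.cast_inj, next]
  split_ifs <;> omega

theorem snd_corner_next {k v : ℕ} (hv : v < 4 * k) :
    (corner k v).2 = (corner k (next k v)).2 ↔ v % 2 = 1 := by
  simp only [corner, Nat.cast_inj, next, height, low]
  grind

theorem segment_eq_edge {k v : ℕ} (hv : v < 4 * k) :
    segment ℝ (corner k v) (corner k (next k v)) = edge k v := by
  have hk : (1 : ℝ) ≤ k := by exact_mod_cast (by omega : 1 ≤ k)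
  rcases index_cases hv with ⟨s, hs, rfl⟩ | ⟨s, hs, rfl⟩ | hl
  · have hlow : (low k s : ℝ) ≤ 2 := by exact_mod_cast (low_le_one k s).trans one_le_two
    rw [next_even, corner_even, corner_odd, segment_of_fst_eq]
    have hu : Set.uIcc (((if s % 2 = 0 then low k s else 2 : ℕ) : ℝ))
        (((if s % 2 = 0 then 2 else low k s : ℕ) : ℝ)) = Set.Icc (low k s : ℝ) 2 := by
      split_ifs
      · exact Set.uIcc_of_le hlow
      · exact Set.uIcc_of_ge hlow
    rw [hu]
    ext p
    simp only [edge, Set.mem_ofPred_eq, Set.mem_Icc]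
    constructor
    · intro h
      exact Or.inl ⟨s, hs, rfl, h⟩
    · rintro (⟨t, -, h, hp⟩ | ⟨t, -, h, -⟩ | ⟨h, -⟩)
      · obtain rfl : s = t := by omega
        exact hp
      · omega
      · omega
  · rw [next_odd hs, corner_top_left hs, corner_top_right k s, segment_of_snd_eq,
      Set.uIcc_of_le (by linarith)]
    ext p
    simp only [edge, Set.mem_ofPred_eq, Set.mem_Icc]
    constructor
    · intro h
      exact Or.inr (Or.inl ⟨s, hs, rfl, h⟩)
    · rintro (⟨t, -, h, -⟩ | ⟨t, -, h, hp⟩ | ⟨h, -⟩)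
      · omega
      · obtain rfl : s = t := by omega
        exact hp
      · omega
  · rw [next_last hl, corner_last hl, corner_zero, segment_of_snd_eq,
      Set.uIcc_of_ge (by linarith)]
    ext p
    simp only [edge, Set.mem_ofPred_eq, Set.mem_Icc]
    constructor
    · intro h
      exact Or.inr (Or.inr ⟨hl, h⟩)
    · rintro (⟨t, -, h, -⟩ | ⟨t, ht, h, -⟩ | ⟨-, hp⟩)
      · omega
      · omega
      · exact hp

theorem corner_inj {k v w : ℕ} (h : corner k v = corner k w) : v = w := by
  have hfst : v / 2 = w / 2 := Nat.cast_injective (R := ℝ) (congrArg Prod.fst h)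
  have hsnd : height k v = height k w := Nat.cast_injective (R := ℝ) (congrArg Prod.snd h)
  have hlow := low_le_one k (w / 2)
  unfold height at hsnd
  rw [hfst] at hsnd
  split_ifs at hsnd <;> omega

theorem roof_pos (s : ℕ) : 0 < roof s := by unfold roof; split_ifs <;> omega

/-- Distinct edges sharing a point are consecutive. -/
theorem next_eq_of_mem_edge {k v w : ℕ} {p : ℝ × ℝ}
    (hv : p ∈ edge k v) (hw : p ∈ edge k w) :
    v = w ∨ next k v = w ∨ next k w = v := by
  wlog hvw : v ≤ w generalizing v w
  · have := this hw hv (by omega)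
    omega
  rcases hv with ⟨s, hs, rfl, h1, h2, h3⟩ | ⟨s, hs, rfl, h1, h2, h3⟩ | ⟨hl, h1, h2, h3⟩ <;>
    rcases hw with ⟨t, ht, rfl, g1, g2, g3⟩ | ⟨t, ht, rfl, g1, g2, g3⟩ | ⟨gl, g1, g2, g3⟩
  · have : s = t := by exact_mod_cast h1.symm.trans g1
    omega
  · rw [h1] at g2
    have : t ≤ s := by exact_mod_cast g2
    right; left
    rw [next_even]; omega
  · rw [g1] at h2
    have : low k s ≤ 0 := by exact_mod_cast h2
    unfold low at this
    split_ifs at this with h h'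
    · right; right; rw [h]; exact next_last gl
    · right; left; rw [next_even]; omega
    · omega
  · rw [g1] at h3
    have : t ≤ s + 1 := by exact_mod_cast h3
    right; left
    rw [next_odd hs]; omega
  · have h4 : t ≤ s + 1 := by exact_mod_cast g2.trans h3
    have h5 : roof s = roof t := by exact_mod_cast h1.symm.trans g1
    unfold roof at h5
    split_ifs at h5 <;> omega
  · have : roof s = 0 := by exact_mod_cast h1.symm.trans g1
    have := roof_pos s
    omega
  all_goals omega

theorem region_mem {k : ℕ} {p : ℝ × ℝ} : p ∈ region k ↔
    ((0 ≤ p.1 ∧ p.1 ≤ 2 * k - 1) ∧ 0 ≤ p.2 ∧ p.2 ≤ 1) ∨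
      ∃ j < k, ((2 * j : ℝ) ≤ p.1 ∧ p.1 ≤ 2 * j + 1) ∧ 0 ≤ p.2 ∧ p.2 ≤ 2 := by
  simp only [region, Set.mem_union, Set.mem_iUnion, Set.mem_prod, Set.mem_Icc, Finset.mem_range,
    exists_prop]

theorem isCompact_region (k : ℕ) : IsCompact (region k) :=
  (isCompact_Icc.prod isCompact_Icc).union <|
    (Finset.range k).isCompact_biUnion fun _ _ => isCompact_Icc.prod isCompact_Icc

/-- The open part of the comb. -/
def openRegion (k : ℕ) : Set (ℝ × ℝ) :=
  Set.Ioo (0 : ℝ) (2 * k - 1) ×ˢ Set.Ioo (0 : ℝ) 1 ∪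
    ⋃ j ∈ Finset.range k, Set.Ioo (2 * j : ℝ) (2 * j + 1) ×ˢ Set.Ioo (0 : ℝ) 2

theorem openRegion_mem {k : ℕ} {p : ℝ × ℝ} : p ∈ openRegion k ↔
    ((0 < p.1 ∧ p.1 < 2 * k - 1) ∧ 0 < p.2 ∧ p.2 < 1) ∨
      ∃ j < k, ((2 * j : ℝ) < p.1 ∧ p.1 < 2 * j + 1) ∧ 0 < p.2 ∧ p.2 < 2 := by
  simp only [openRegion, Set.mem_union, Set.mem_iUnion, Set.mem_prod, Set.mem_Ioo,
    Finset.mem_range, exists_prop]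

theorem openRegion_subset_interior (k : ℕ) : openRegion k ⊆ interior (region k) := by
  refine interior_maximal ?_ ?_
  · exact Set.union_subset_union (Set.prod_mono Set.Ioo_subset_Icc_self Set.Ioo_subset_Icc_self)
      (Set.iUnion₂_mono fun _ _ => Set.prod_mono Set.Ioo_subset_Icc_self Set.Ioo_subset_Icc_self)
  · exact (isOpen_Ioo.prod isOpen_Ioo).union
      (isOpen_biUnion fun _ _ => isOpen_Ioo.prod isOpen_Ioo)

theorem mem_edge_of_notMem_openRegion {k : ℕ} {p : ℝ × ℝ} (hp : p ∈ region k)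
    (hn : p ∉ openRegion k) : ∃ v < 4 * k, p ∈ edge k v := by
  obtain ⟨a, b⟩ := p
  rw [openRegion_mem] at hn
  rw [region_mem] at hp
  push Not at hn
  obtain ⟨hbase, hprong⟩ := hn
  simp only at hp hbase hprong
  have hside : ∀ s < 2 * k, a = s → (low k s : ℝ) ≤ b → b ≤ 2 →
      ∃ v < 4 * k, (a, b) ∈ edge k v := fun s hs h1 h2 h3 =>
    ⟨2 * s, by omega, Or.inl ⟨s, hs, rfl, h1, h2, h3⟩⟩
  have htop : ∀ s, s + 1 < 2 * k → b = roof s → (s : ℝ) ≤ a → a ≤ s + 1 →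
      ∃ v < 4 * k, (a, b) ∈ edge k v := fun s hs h1 h2 h3 =>
    ⟨2 * s + 1, by omega, Or.inr (Or.inl ⟨s, hs, rfl, h1, h2, h3⟩)⟩
  by_cases hcase : (0 ≤ a ∧ a ≤ 2 * k - 1) ∧ 0 ≤ b ∧ b ≤ 1
  · obtain ⟨⟨ha0, ha1⟩, hb0, hb1⟩ := hcase
    have hk : 0 < k := by
      rcases Nat.eq_zero_or_pos k with rfl | h
      · norm_num at ha1; linarith
      · exact h
    rcases hb0.eq_or_lt with hb | hb
    · exact ⟨4 * k - 1, by omega, Or.inr (Or.inr ⟨by omega, hb.symm, ha0, ha1⟩)⟩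
    rcases ha0.eq_or_lt with ha | ha
    · exact hside 0 (by omega) (by simp [ha]) (by simp [low, hb0]) (by linarith)
    rcases ha1.eq_or_lt with ha' | ha'
    · refine hside (2 * k - 1) (by omega) ?_ ?_ (by linarith)
      · rw [ha', Nat.cast_sub (by omega)]; push_cast; ring
      · have : low k (2 * k - 1) = 0 := by unfold low; split_ifs <;> omega
        simp [this, hb0]
    have hb2 : b = 1 := le_antisymm hb1 (hbase ⟨ha, ha'⟩ hb)
    have hfl := Nat.floor_le ha0
    have hfl' := Nat.lt_floor_add_one a
    set s := ⌊a⌋₊ with hs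
    have hsk : s + 1 < 2 * k := by
      have : (s : ℝ) + 1 < 2 * k := by linarith
      exact_mod_cast this
    rcases Nat.even_or_odd' s with ⟨j, hj | hj⟩
    · have hc : (s : ℝ) = 2 * j := by rw [hj]; push_cast; ring
      rcases hfl.eq_or_lt with h | h
      · exact hside s (by omega) h.symm
          (by rw [hb2]; exact_mod_cast low_le_one k s) (by linarith)
      · have := hprong j (by omega) ⟨by linarith, by linarith⟩ hb
        linarith
    · refine htop s hsk ?_ hfl hfl'.le
      have : roof s = 1 := by unfold roof; split_ifs <;> omega
      simp [this, hb2]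
  · rcases hp with hp | ⟨j, hj, ⟨h1, h2⟩, h3, h4⟩
    · exact absurd hp hcase
    have hjk : (j : ℝ) + 1 ≤ k := by exact_mod_cast hj
    have hj0 : (0 : ℝ) ≤ j := by positivity
    have hb : 1 < b := by
      by_contra hb
      exact hcase ⟨⟨by linarith, by linarith⟩, h3, not_lt.mp hb⟩
    have hlow : ∀ s, (low k s : ℝ) ≤ b := fun s =>
      le_trans (by exact_mod_cast low_le_one k s) hb.le
    rcases h1.eq_or_lt with h | h
    · exact hside (2 * j) (by omega) (by push_cast; exact h.symm) (hlow _) h4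
    rcases h2.eq_or_lt with h' | h'
    · exact hside (2 * j + 1) (by omega) (by push_cast; exact h') (hlow _) h4
    have hb2 : b = 2 := le_antisymm h4 (hprong j hj ⟨h, h'⟩ (by linarith))
    refine htop (2 * j) (by omega) ?_ (by push_cast; linarith) (by push_cast; linarith)
    simp [roof, hb2]

theorem edge_subset_region {k v : ℕ} : edge k v ⊆ region k := by
  rintro ⟨a, b⟩ h
  rw [region_mem]
  simp only
  rcases h with ⟨s, hs, rfl, h1, h2, h3⟩ | ⟨s, hs, rfl, h1, h2, h3⟩ | ⟨hl, h1, h2, h3⟩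
  · simp only at h1 h2 h3
    have hb : 0 ≤ b := le_trans (by positivity) h2
    rcases Nat.even_or_odd' s with ⟨j, rfl | rfl⟩ <;> push_cast at h1 <;>
      exact Or.inr ⟨j, by omega, ⟨by linarith, by linarith⟩, hb, h3⟩
  · simp only at h1 h2 h3
    rcases Nat.even_or_odd' s with ⟨j, rfl | rfl⟩ <;> push_cast at h2 h3
    · have h4 : roof (2 * j) = 2 := by simp [roof]
      rw [h4] at h1
      push_cast at h1
      exact Or.inr ⟨j, by omega, ⟨h2, h3⟩, by linarith, h1.le⟩
    · have h4 : roof (2 * j + 1) = 1 := by unfold roof; split_ifs <;> omega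
      rw [h4] at h1
      push_cast at h1
      have hs' : (2 * (j : ℝ) + 1) + 1 + 1 ≤ 2 * k := by exact_mod_cast hs
      have hj : (0 : ℝ) ≤ j := by positivity
      exact Or.inl ⟨⟨by linarith, by linarith⟩, by linarith, h1.le⟩
  · simp only at h1 h2 h3
    exact Or.inl ⟨⟨h2, h3⟩, h1.ge, by linarith⟩

/-- A closed box whose open part misses `s` contains no interior point of `s`. -/
theorem notMem_interior_of_box {s : Set (ℝ × ℝ)} {a b c d : ℝ} (hab : a < b) (hcd : c < d)
    (h : ∀ x y, a < x → x < b → c < y → y < d → (x, y) ∉ s) {p : ℝ × ℝ}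
    (h1 : a ≤ p.1) (h2 : p.1 ≤ b) (h3 : c ≤ p.2) (h4 : p.2 ≤ d) : p ∉ interior s := by
  have hp : p ∈ closure (Set.Ioo a b ×ˢ Set.Ioo c d) := by
    rw [closure_prod_eq, closure_Ioo hab.ne, closure_Ioo hcd.ne]
    exact ⟨⟨h1, h2⟩, h3, h4⟩
  have hsub : Set.Ioo a b ×ˢ Set.Ioo c d ⊆ sᶜ := fun q hq =>
    h q.1 q.2 hq.1.1 hq.1.2 hq.2.1 hq.2.2
  have := closure_mono hsub hp
  rwa [closure_compl] at this

/-- The gaps between the prongs are outside of the comb. -/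
theorem notMem_region_of_gap {k j : ℕ} {x y : ℝ} (h1 : 2 * (j : ℝ) + 1 < x)
    (h2 : x < 2 * j + 2) (hy : 1 < y) : (x, y) ∉ region k := by
  rw [region_mem]
  rintro (⟨-, -, h⟩ | ⟨i, -, ⟨h3, h4⟩, -⟩)
  · linarith
  · have h5 : i < j + 1 := by
      have : 2 * (i : ℝ) < 2 * (j + 1) := by simp only at h3; linarith
      exact_mod_cast lt_of_mul_lt_mul_left this zero_le_two
    have h6 : j < i := by
      have : 2 * (j : ℝ) < 2 * i := by simp only at h4; linarith
      exact_mod_cast lt_of_mul_lt_mul_left this zero_le_two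
    omega

theorem region_subset_box {k : ℕ} {p : ℝ × ℝ} (hp : p ∈ region k) :
    0 ≤ p.1 ∧ p.1 ≤ 2 * k - 1 ∧ 0 ≤ p.2 ∧ p.2 ≤ 2 := by
  rcases region_mem.mp hp with ⟨⟨h1, h2⟩, h3, h4⟩ | ⟨j, hj, ⟨h1, h2⟩, h3, h4⟩
  · exact ⟨h1, h2, h3, by linarith⟩
  · have hjk : (j : ℝ) + 1 ≤ k := by exact_mod_cast hj
    have hj0 : (0 : ℝ) ≤ j := by positivity
    exact ⟨by linarith, by linarith, h3, h4⟩

theorem notMem_interior_of_mem_edge {k v : ℕ} (hk : 0 < k) {p : ℝ × ℝ} (hp : p ∈ edge k v) :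
    p ∉ interior (region k) := by
  have hk' : (1 : ℝ) ≤ k := by exact_mod_cast hk
  rcases hp with ⟨s, hs, rfl, h1, h2, h3⟩ | ⟨s, hs, rfl, h1, h2, h3⟩ | ⟨hl, h1, h2, h3⟩
  · by_cases hs0 : s = 0
    · subst hs0
      push_cast at h1
      refine notMem_interior_of_box (a := -1) (b := 0) (c := 0) (d := 2) (by norm_num)
        (by norm_num) ?_ (by linarith) h1.le (le_trans (by positivity) h2) h3
      intro x y _ hx _ _ h
      have := (region_subset_box h).1
      simp only at this
      linarith
    by_cases hsl : s + 1 = 2 * k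
    · have hc : (s : ℝ) + 1 = 2 * k := by exact_mod_cast hsl
      refine notMem_interior_of_box (a := 2 * k - 1) (b := 2 * k) (c := 0) (d := 2) (by linarith)
        (by norm_num) ?_ (by linarith) (by linarith) (le_trans (by positivity) h2) h3
      intro x y hx _ _ _ h
      have := (region_subset_box h).2.1
      simp only at this
      linarith
    have hlow : low k s = 1 := by simp [low, hs0, hsl]
    rw [hlow, Nat.cast_one] at h2
    obtain ⟨j, hj⟩ : ∃ j, s = 2 * j + 1 ∨ s = 2 * j + 2 := ⟨(s - 1) / 2, by omega⟩
    have hx : 2 * (j : ℝ) + 1 ≤ p.1 ∧ p.1 ≤ 2 * j + 2 := by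
      rw [h1]
      rcases hj with rfl | rfl <;> push_cast <;> constructor <;> linarith
    exact notMem_interior_of_box (by linarith) one_lt_two
      (fun x y hx hx' hy _ => notMem_region_of_gap hx hx' hy) hx.1 hx.2 h2 h3
  · rcases Nat.even_or_odd' s with ⟨j, rfl | rfl⟩ <;> push_cast at h2 h3
    · have h4 : roof (2 * j) = 2 := by simp [roof]
      rw [h4] at h1
      push_cast at h1
      refine notMem_interior_of_box (c := 2) (d := 3) (by linarith) (by norm_num) ?_
        h2 h3 h1.ge (by linarith)
      intro x y _ _ hy _ h
      have := (region_subset_box h).2.2.2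
      simp only at this
      linarith
    · have h4 : roof (2 * j + 1) = 1 := by unfold roof; split_ifs <;> omega
      rw [h4] at h1
      push_cast at h1
      exact notMem_interior_of_box (b := 2 * (j : ℝ) + 2) (by linarith) one_lt_two
        (fun x y hx hx' hy _ => notMem_region_of_gap hx hx' hy) h2 (by linarith) h1.ge
        (by linarith)
  · refine notMem_interior_of_box (c := -1) (d := 0) (by linarith : (0 : ℝ) < 2 * k - 1)
      (by norm_num) ?_ h2 h3 (by linarith) h1.le
    intro x y _ _ _ hy h
    have := (region_subset_box h).2.2.1
    simp only at this
    linarith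

theorem frontier_region {k : ℕ} (hk : 0 < k) :
    frontier (region k) = {p | ∃ v < 4 * k, p ∈ edge k v} := by
  rw [(isCompact_region k).isClosed.frontier_eq]
  ext p
  constructor
  · rintro ⟨hp, hn⟩
    exact mem_edge_of_notMem_openRegion hp fun h => hn (openRegion_subset_interior k h)
  · rintro ⟨v, -, hp⟩
    exact ⟨edge_subset_region hp, notMem_interior_of_mem_edge hk hp⟩

/-- The length of the `v`-th edge. -/
def len (k v : ℕ) : ℕ :=
  1 + (if v = 0 then 1 else 0) + (if v = 4 * k - 2 then 1 else 0) +
    (if v = 4 * k - 1 then 2 * k - 2 else 0)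

theorem dist_corner_next {k v : ℕ} (hv : v < 4 * k) :
    dist (corner k v) (corner k (next k v)) = len k v := by
  rcases index_cases hv with ⟨s, hs, rfl⟩ | ⟨s, hs, rfl⟩ | hl
  · have hlen : (len k (2 * s) : ℝ) = 2 - low k s := by
      rw [eq_sub_iff_add_eq]
      norm_cast
      unfold len low
      split_ifs <;> omega
    have hlow : (low k s : ℝ) ≤ 1 := by exact_mod_cast low_le_one k s
    rw [next_even, corner_even, corner_odd, hlen, Prod.dist_eq]
    rw [dist_self, max_eq_right dist_nonneg, Real.dist_eq]
    split_ifs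
    · rw [abs_of_nonpos] <;> push_cast <;> linarith
    · rw [abs_of_nonneg] <;> push_cast <;> linarith
  · have hlen : len k (2 * s + 1) = 1 := by
      unfold len
      split_ifs <;> first | contradiction | omega
    rw [next_odd hs, corner_top_left hs, corner_top_right k s, hlen, Prod.dist_eq]
    simp
  · have hlen : (len k v : ℝ) = 2 * k - 1 := by
      rw [eq_sub_iff_add_eq]
      norm_cast
      unfold len
      split_ifs <;> omega
    have hk : (1 : ℝ) ≤ k := by exact_mod_cast (by omega : 1 ≤ k)
    rw [next_last hl, corner_last hl, corner_zero, hlen, Prod.dist_eq]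
    rw [dist_self, max_eq_left dist_nonneg, Real.dist_eq, sub_zero]
    exact abs_of_nonneg (by linarith)

theorem sum_len {k : ℕ} (hk : 0 < k) : ∑ v ∈ Finset.range (4 * k), len k v = 6 * k := by
  simp only [len, Finset.sum_add_distrib, Finset.sum_const, Finset.card_range,
    Finset.sum_ite_eq', Finset.mem_range, smul_eq_mul]
  split_ifs <;> omega

/-- The comb with `k` prongs as an integral orthogonal polygon. -/
def polygon (k : ℕ) (hk : 0 < k) : IntegralOrthoPolygon (4 * k) where
  vertex i := corner k i.val
  inj := by
    have : NeZero (4 * k) := ⟨by omega⟩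
    exact fun i j h => ZMod.val_injective _ (corner_inj h)
  axis i := by
    have : NeZero (4 * k) := ⟨by omega⟩
    rw [val_add_one hk]
    rcases index_cases (ZMod.val_lt i) with ⟨s, hs, h⟩ | ⟨s, hs, h⟩ | hl
    · rw [h, next_even, corner_even, corner_odd]
      exact Or.inl rfl
    · rw [h, next_odd hs, corner_top_left hs, corner_top_right k s]
      exact Or.inr rfl
    · rw [next_last hl, corner_last hl, corner_zero]
      exact Or.inr rfl
  corner i := by
    have : NeZero (4 * k) := ⟨by omega⟩
    simp only [val_add_one hk]
    have hi := ZMod.val_lt i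
    have hn := next_lt hi
    rw [fst_corner_next, fst_corner_next, snd_corner_next hi, snd_corner_next hn]
    have := next_mod_two k i.val
    omega
  nonadj_disjoint i j hij hi hj := by
    have : NeZero (4 * k) := ⟨by omega⟩
    rw [val_add_one hk, val_add_one hk, segment_eq_edge (ZMod.val_lt i),
      segment_eq_edge (ZMod.val_lt j), Set.disjoint_left]
    intro p hp hq
    rcases next_eq_of_mem_edge hp hq with h | h | h
    · exact hij (ZMod.val_injective _ h)
    · exact hi (ZMod.val_injective _ ((val_add_one hk i).trans h))
    · exact hj (ZMod.val_injective _ ((val_add_one hk j).trans h))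
  adj_inter i := by
    have : NeZero (4 * k) := ⟨by omega⟩
    simp only [val_add_one hk]
    have hi := ZMod.val_lt i
    have hn := next_lt hi
    have hmod := next_mod_two k i.val
    rcases Nat.mod_two_eq_zero_or_one i.val with h | h
    · exact segment_inter_segment_of_fst_eq ((fst_corner_next).mpr h)
        ((snd_corner_next hn).mpr (by omega))
    · rw [Set.inter_comm, segment_symm, segment_symm ℝ (corner k i.val)]
      exact segment_inter_segment_of_fst_eq ((fst_corner_next).mpr (by omega)).symm
        ((snd_corner_next hi).mpr h).symm
  integral_edges i := by
    have : NeZero (4 * k) := ⟨by omega⟩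
    exact ⟨len k i.val, by rw [val_add_one hk, dist_corner_next (ZMod.val_lt i)]⟩
  region := region k
  region_compact := isCompact_region k
  region_frontier := by
    have : NeZero (4 * k) := ⟨by omega⟩
    rw [frontier_region hk]
    ext p
    simp only [Set.mem_ofPred_eq, Set.mem_iUnion]
    constructor
    · rintro ⟨v, hv, hp⟩
      refine ⟨(v : ZMod (4 * k)), ?_⟩
      rwa [val_add_one hk, ZMod.val_natCast_of_lt hv, segment_eq_edge hv]
    · rintro ⟨i, hp⟩
      rw [val_add_one hk, segment_eq_edge (ZMod.val_lt i)] at hp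
      exact ⟨i.val, ZMod.val_lt i, hp⟩

/-- A point at the top of the `j`-th prong. Its offset inside the prong strictly decreases with
`j`, so that no point of the comb sees two of these points. -/
noncomputable def peak (j : ℕ) : ℝ × ℝ := (2 * j + 1 / (j + 1), 2)

theorem offset_bounds (j : ℕ) : 0 < 1 / ((j : ℝ) + 1) ∧ 1 / ((j : ℝ) + 1) ≤ 1 := by
  refine ⟨by positivity, ?_⟩
  rw [div_le_one (by positivity)]
  linarith [(by positivity : (0 : ℝ) ≤ j)]

theorem exists_scale {u d : ℝ} (hu : 0 ≤ u) (hd : 2 * u < d) :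
    ∃ s : ℝ, 0 ≤ s ∧ s < 1 / 2 ∧ u < s * d ∧ s * d < u + 1 := by
  have hd0 : 0 < d := by linarith
  have h : u / d < min (1 / 2) ((u + 1) / d) := by
    refine lt_min ?_ (by gcongr; linarith)
    rw [div_lt_iff₀ hd0]
    linarith
  obtain ⟨s, h1, h2⟩ := exists_between h
  exact ⟨s, (div_nonneg hu hd0.le).trans h1.le, h2.trans_le (min_le_left _ _),
    (div_lt_iff₀ hd0).mp h1, (lt_div_iff₀ hd0).mp (h2.trans_le (min_le_right _ _))⟩

theorem fst_bounds_of_sees_peak {k j : ℕ} {p : ℝ × ℝ}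
    (h : Sees (region k) p (peak j)) :
    2 * (j : ℝ) - 1 / (j + 1) ≤ p.1 ∧ p.1 ≤ 2 * j + 2 - 1 / (j + 1) := by
  obtain ⟨h0, h1⟩ := offset_bounds j
  have hseg : ∀ s : ℝ, 0 ≤ s → s < 1 / 2 →
      (2 * (j : ℝ) + 1 / (j + 1) + s * (p.1 - (2 * j + 1 / (j + 1))), 2 + s * (p.2 - 2)) ∈
        region k := by
    intro s hs hs'
    refine h ⟨s, 1 - s, hs, by linarith, by ring, Prod.ext ?_ ?_⟩
    · simp only [peak, Prod.fst_add, Prod.smul_fst, smul_eq_mul]; ring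
    · simp only [peak, Prod.snd_add, Prod.smul_snd, smul_eq_mul]; ring
  obtain ⟨hp0, -, hp2, -⟩ := region_subset_box (h (left_mem_segment ℝ _ _))
  have hheight : ∀ s : ℝ, 0 ≤ s → s < 1 / 2 → 1 < 2 + s * (p.2 - 2) := by
    intro s hs hs'
    nlinarith [mul_nonneg hs hp2]
  set t : ℝ := 1 / (j + 1)
  constructor
  · by_contra! hlt
    obtain ⟨s, hs, hs', hlo, hhi⟩ :=
      exists_scale (u := t) (d := 2 * j + t - p.1) h0.le (by linarith)
    cases j with
    | zero =>
      have := (region_subset_box (hseg s hs hs')).1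
      push_cast at this hlo
      linarith
    | succ i =>
      refine notMem_region_of_gap (j := i) ?_ ?_ (hheight s hs hs') (hseg s hs hs') <;>
        push_cast at hlo hhi ⊢ <;> linarith
  · by_contra! hlt
    obtain ⟨s, hs, hs', hlo, hhi⟩ :=
      exists_scale (u := 1 - t) (d := p.1 - (2 * j + t)) (by linarith) (by linarith)
    exact notMem_region_of_gap (j := j) (by linarith) (by linarith) (hheight s hs hs')
      (hseg s hs hs')

theorem card_le_of_guards {k : ℕ} {S : Finset (ℝ × ℝ)}
    (hS : GuardsRegion (region k) S) : k ≤ S.card := by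
  have hpeak : ∀ j ∈ Finset.range k, ∃ p ∈ S, Sees (region k) p (peak j) := by
    intro j hj
    refine hS.2 _ (region_mem.mpr (Or.inr ⟨j, Finset.mem_range.mp hj, ?_⟩))
    obtain ⟨h1, h2⟩ := offset_bounds j
    exact ⟨⟨by simp only [peak]; linarith, by simp only [peak]; linarith⟩, zero_le_two, le_rfl⟩
  choose! f hf hsee using hpeak
  have key : ∀ i ∈ Finset.range k, ∀ j ∈ Finset.range k, i < j → f i ≠ f j := by
    intro i hi j hj hij heq
    have h1 := (fst_bounds_of_sees_peak (hsee i hi)).2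
    have h2 := (fst_bounds_of_sees_peak (hsee j hj)).1
    rw [heq] at h1
    have h3 : (i : ℝ) + 1 ≤ j := by exact_mod_cast hij
    have h4 : 1 / ((j : ℝ) + 1) < 1 / (i + 1) :=
      one_div_lt_one_div_of_lt (by positivity) (by linarith)
    linarith
  have hinj : Set.InjOn f (Finset.range k) := by
    intro i hi j hj heq
    rcases lt_trichotomy i j with h | h | h
    · exact absurd heq (key i hi j hj h)
    · exact h
    · exact absurd heq.symm (key j hj i hi h)
  simpa using Finset.card_le_card_of_injOn f hf hinj

end Comb

/-- For every even `N ≥ 6` divisible by 6 there is a simple orthogonal polygon with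
integer edge lengths and perimeter `N` that requires at least `N/6` point guards. -/
theorem stmt_15 (N : ℕ) (hN : 6 ≤ N) (h6 : 6 ∣ N) (heven : Even N) :
    ∃ (n : ℕ) (P : IntegralOrthoPolygon n), 0 < n ∧
      (∑ i ∈ Finset.range n,
        dist (P.vertex (i : ZMod n)) (P.vertex ((i : ZMod n) + 1))) = (N : ℝ) ∧
      ∀ S : Finset (ℝ × ℝ), GuardsRegion P.region ↑S → N / 6 ≤ S.card := by
  obtain ⟨k, rfl⟩ := h6
  have hk : 0 < k := by omega
  have : NeZero (4 * k) := ⟨by omega⟩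
  refine ⟨4 * k, Comb.polygon k hk, by omega, ?_, fun S hS => ?_⟩
  · rw [← Comb.sum_len hk, Nat.cast_sum]
    refine Finset.sum_congr rfl fun v hv => ?_
    have hv' := Finset.mem_range.mp hv
    simp only [Comb.polygon]
    rw [Comb.val_add_one hk, ZMod.val_natCast_of_lt hv', Comb.dist_corner_next hv']
  · rw [Nat.mul_div_cancel_left k (by norm_num)]
    exact Comb.card_le_of_guards hS
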